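/- Define σ = (e_n*)^max ··· (e_2*)^max (e_1*)^max ∘ f_n^{a_n} ··· f_2^{a_2} f_1^{a_1}, where the a_k are chosen inductively as a_k = ur_k + ur_k* evaluated at f_{k-1}^{a_{k-1}} ··· f_1^{a_1}(M). Then for every multisegment M ∈ MS_n, σ(M) is the multisegment obtained from M by removing all segments of the form [1,j] and replacing every remaining segment [i,j] (i ≥ 2) by [i-1, j-1]. -/

import Mathlib

/-- A segment `[a,b]` is a pair of integers. -/
abbrev Seg : Type := ℕ × ℕ

/-- A multisegment is a finite multiset of segments. -/
abbrev MS : Type := Multiset Seg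

/-- `M ∈ MS_n`: all segments `[a,b]` satisfy `1 ≤ a ≤ b ≤ n`. -/
def IsMS (n : ℕ) (M : MS) : Prop := ∀ s ∈ M, 1 ≤ s.1 ∧ s.1 ≤ s.2 ∧ s.2 ≤ n

/-- A bracket: `op` = "(", `cl` = ")". -/
inductive Br | op | cl
deriving DecidableEq

/-- One step of the left-to-right bracket cancellation procedure.  The state
`(cls, ops)` records the tags of the currently uncanceled ")" (in order) and the
currently uncanceled "(" (in order).  A new "(" is appended to `ops`; a new ")"
cancels the last uncanceled "(" if there is one, and otherwise is appended to `cls`. -/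
def step {τ : Type} : (List τ × List τ) → (Br × τ) → (List τ × List τ)
  | (cls, ops), (Br.op, s) => (cls, ops ++ [s])
  | (cls, ops), (Br.cl, s) => if ops.isEmpty then (cls ++ [s], ops) else (cls, ops.dropLast)

/-- Process a tagged bracket string; the result `(cls, ops)` lists the tags of the
uncanceled ")" and the uncanceled "(" (left to right).  The reduced (uncanceled)
string is `")"^cls.length ++ "("^ops.length`. -/
def scan {τ : Type} (l : List (Br × τ)) : List τ × List τ := l.foldl step ([], [])

/-- Number of uncanceled ")" in a tagged bracket string. -/
def urStr {τ : Type} (l : List (Br × τ)) : ℕ := (scan l).1.length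

/-- Number of uncanceled "(" in a tagged bracket string. -/
def epsStr {τ : Type} (l : List (Br × τ)) : ℕ := (scan l).2.length

/-- Tag of the rightmost uncanceled ")", if any. -/
def lastCl {τ : Type} (l : List (Br × τ)) : Option τ := (scan l).1.getLast?

/-- Tag of the leftmost uncanceled "(", if any. -/
def headOp {τ : Type} (l : List (Br × τ)) : Option τ := (scan l).2.head?

/-- The string `S_i(M)`: segments are ordered by increasing height, then by
decreasing lower endpoint; each `[h,i]` contributes "(" and each `[h,i-1]`
contributes ")".  In the block of segments of height `t` the "(" over the
`[i-t+1, i]` segments come immediately before the ")" over the `[i-t, i-1]`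
segments, and blocks appear for `t = 1, 2, …`. -/
def Si (M : MS) (i : ℕ) : List (Br × Seg) :=
  (List.range i).flatMap fun t0 =>
    let t := t0 + 1
    List.replicate (M.count (i - t + 1, i)) (Br.op, ((i - t + 1 : ℕ), i)) ++
    List.replicate (M.count (i - t, i - 1)) (Br.cl, ((i - t : ℕ), i - 1))

/-- The string `S_i^*(M)`: segments ordered by increasing height, then by
increasing lower endpoint; each `[i,j]` contributes "(" and each `[i+1,j]`
contributes ")".  In the block of height `t` the "(" below the `[i, i+t-1]`
segments come immediately before the ")" below the `[i+1, i+t]` segments. -/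
def SiStar (n : ℕ) (M : MS) (i : ℕ) : List (Br × Seg) :=
  (List.range n).flatMap fun t0 =>
    let t := t0 + 1
    List.replicate (M.count (i, i + t - 1)) (Br.op, (i, i + t - 1)) ++
    List.replicate (M.count (i + 1, i + t)) (Br.cl, (i + 1, i + t))

/-- The crystal operator `f_i` on multisegments: it changes the segment `[h,i-1]`
under the rightmost uncanceled ")" of `S_i(M)` into `[h,i]`, or adds a new
segment `[i,i]` if there is no uncanceled ")". -/
def fM (i : ℕ) (M : MS) : MS :=
  match lastCl (Si M i) with
  | some s => M.erase s + {(s.1, i)}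
  | none => M + {(i, i)}

/-- The crystal operator `e_i` on multisegments: it changes the segment `[h,i]`
under the leftmost uncanceled "(" of `S_i(M)` into `[h,i-1]` (deleting it when
`h = i`), or returns `none` (i.e. `0`) if there is no uncanceled "(". -/
def eM (i : ℕ) (M : MS) : Option MS :=
  match headOp (Si M i) with
  | some s => some (if s.1 = i then M.erase s else M.erase s + {(s.1, i - 1)})
  | none => none

/-- The operator `f_i^*`: it changes the segment `[i+1,j]` under the rightmost
uncanceled ")" of `S_i^*(M)` into `[i,j]`, or adds `[i,i]` if there is none. -/
def fMStar (n i : ℕ) (M : MS) : MS :=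
  match lastCl (SiStar n M i) with
  | some s => M.erase s + {(i, s.2)}
  | none => M + {(i, i)}

/-- The operator `e_i^*`: it changes the segment `[i,j]` under the leftmost
uncanceled "(" of `S_i^*(M)` into `[i+1,j]` (deleting it when `j = i`), or
returns `none` if there is no uncanceled "(". -/
def eMStar (n i : ℕ) (M : MS) : Option MS :=
  match headOp (SiStar n M i) with
  | some s => some (if s.2 = i then M.erase s else M.erase s + {(i + 1, s.2)})
  | none => none

/-- The number of boxes labeled `j` in `M`: each segment `[a,b]` contains one
box labeled `j` for each `a ≤ j ≤ b`. -/
def boxes (M : MS) (j : ℕ) : ℕ :=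
  (M.filter (fun s => s.1 ≤ j ∧ j ≤ s.2)).card

/-- The pairing `⟨wt(M), α_i^∨⟩ = #(boxes i-1) + #(boxes i+1) - 2 #(boxes i)`. -/
def wtPair (M : MS) (i : ℕ) : ℤ :=
  (boxes M (i - 1) : ℤ) + (boxes M (i + 1) : ℤ) - 2 * (boxes M i : ℤ)


/-- The sequence `M = M^(0), M^(1), …`, where `M^(k+1)` is obtained from `M^(k)`
by applying `f_{k+1}` exactly `a_{k+1} = ur_{k+1}(M^(k)) + ur_{k+1}^*(M^(k))` times. -/
def Mseq (n : ℕ) (M : MS) : ℕ → MS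
  | 0 => M
  | k + 1 =>
      (fM (k + 1))^[urStr (Si (Mseq n M k) (k + 1)) + urStr (SiStar n (Mseq n M k) (k + 1))]
        (Mseq n M k)

/-- The size of a multisegment: total number of boxes. -/
def msSize (M : MS) : ℕ := (M.map (fun s => s.2 + 1 - s.1)).sum

/-- Auxiliary fuelled iteration of `e_i^*`. -/
def eStarMaxAux (n i : ℕ) : ℕ → MS → MS
  | 0, M => M
  | fuel + 1, M =>
      match eMStar n i M with
      | none => M
      | some M' => eStarMaxAux n i fuel M'

/-- `(e_i^*)^max`: apply `e_i^*` until it returns `0`.  (Each application of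
`e_i^*` strictly decreases the size, so `msSize M` steps of fuel suffice.) -/
def eStarMax (n i : ℕ) (M : MS) : MS := eStarMaxAux n i (msSize M) M

/-- `σ = (e_n^*)^max ⋯ (e_1^*)^max ∘ f_n^{a_n} ⋯ f_1^{a_1}` with the `a_k`
chosen inductively as `a_k = ur_k + ur_k^*` evaluated at `f_{k-1}^{a_{k-1}} ⋯ f_1^{a_1}(M)`. -/
def sigmaMS (n : ℕ) (M : MS) : MS :=
  (List.range n).foldl (fun A k => eStarMax n (k + 1) A) (Mseq n M n)

/-- The fold of `step` over a run of opening brackets. -/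
theorem foldl_step_op {τ : Type} (a : ℕ) (s : τ) (c o : List τ) :
    (List.replicate a (Br.op, s)).foldl step (c, o) = (c, o ++ List.replicate a s) := by
  induction a generalizing o with
  | zero => simp
  | succ a ih => simp [List.replicate_succ, step, ih]

/-- The fold of `step` over a run of closing brackets. -/
theorem foldl_step_cl {τ : Type} (b : ℕ) (s : τ) (c o : List τ) :
    (List.replicate b (Br.cl, s)).foldl step (c, o) =
      (c ++ List.replicate (b - o.length) s, o.take (o.length - b)) := by
  induction b generalizing c o with
  | zero => simp
  | succ b ih =>
    rw [List.replicate_succ, List.foldl_cons]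
    rcases o with _ | ⟨x, o⟩
    · simp [step, ih, List.replicate_succ]
    · simp only [step, List.isEmpty_cons, Bool.false_eq_true, if_false, ih,
        List.length_dropLast, List.length_cons, Nat.add_sub_cancel, Nat.add_sub_add_right]
      rw [List.dropLast_eq_take, List.take_take]
      simp

/-- The bracket string made of `N` successive blocks, the `t`-th consisting of `a t`
brackets "(" followed by `b t` brackets ")". -/
def blockStr {τ : Type} (a b : ℕ → ℕ) (s s' : ℕ → τ) (N : ℕ) : List (Br × τ) :=
  (List.range N).flatMap fun t =>
    List.replicate (a t) (Br.op, s t) ++ List.replicate (b t) (Br.cl, s' t)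

section blockStr

variable {τ : Type} (a b : ℕ → ℕ) (s s' : ℕ → τ)

theorem scan_blockStr_succ (N : ℕ) :
    scan (blockStr a b s s' (N + 1)) =
      ((scan (blockStr a b s s' N)).1 ++
          List.replicate (b N - ((scan (blockStr a b s s' N)).2.length + a N)) (s' N),
        ((scan (blockStr a b s s' N)).2 ++ List.replicate (a N) (s N)).take
          ((scan (blockStr a b s s' N)).2.length + a N - b N)) := by
  have h : blockStr a b s s' (N + 1) = blockStr a b s s' N ++
      (List.replicate (a N) (Br.op, s N) ++ List.replicate (b N) (Br.cl, s' N)) := by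
    simp [blockStr, List.range_succ]
  rw [h]
  unfold scan
  rw [List.foldl_append, List.foldl_append]
  generalize List.foldl step ([], []) (blockStr a b s s' N) = x
  obtain ⟨c, o⟩ := x
  rw [foldl_step_op, foldl_step_cl]
  simp

theorem scan_blockStr_zero : scan (blockStr a b s s' 0) = ([], []) := by
  simp [scan, blockStr]

theorem scan_blockStr_of_le {T : ℕ} (h : ∀ t < T, a t ≤ b t) :
    (scan (blockStr a b s s' T)).2 = [] ∧
      (scan (blockStr a b s s' T)).1.length = ∑ t ∈ Finset.range T, (b t - a t) := by
  induction T with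
  | zero => simp [scan_blockStr_zero]
  | succ T ih =>
    obtain ⟨h1, h2⟩ := ih fun t ht => h t (by omega)
    have := h T (by omega)
    rw [scan_blockStr_succ, h1]
    simp [h2, Finset.sum_range_succ, this]

theorem scan_blockStr_fst_of_ge {T N : ℕ} (hTN : T ≤ N)
    (h : ∀ t, T ≤ t → t < N → b t ≤ a t) :
    (scan (blockStr a b s s' N)).1 = (scan (blockStr a b s s' T)).1 := by
  induction N, hTN using Nat.le_induction with
  | base => rfl
  | succ N hN ih =>
    have := h N hN (by omega)
    have h0 : b N - ((scan (blockStr a b s s' N)).2.length + a N) = 0 := by omega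
    rw [scan_blockStr_succ, h0]
    simpa using ih fun t h1 h2 => h t h1 (by omega)

theorem sum_closes_le (N m : ℕ) (hm : m ≤ N) :
    ∑ t ∈ Finset.range m, b t ≤
      urStr (blockStr a b s s' N) + ∑ t ∈ Finset.range m, a t := by
  have key : ∀ m, (∑ t ∈ Finset.range m, b t) + (scan (blockStr a b s s' m)).2.length =
      (scan (blockStr a b s s' m)).1.length + ∑ t ∈ Finset.range m, a t := by
    intro m
    induction m with
    | zero => simp [scan_blockStr_zero]
    | succ m ih =>
      rw [scan_blockStr_succ, Finset.sum_range_succ, Finset.sum_range_succ]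
      simp only [List.length_append, List.length_replicate, List.length_take]
      omega
  have mono : (scan (blockStr a b s s' m)).1.length ≤ urStr (blockStr a b s s' N) := by
    induction N, hm using Nat.le_induction with
    | base => exact le_rfl
    | succ N _ ih =>
      refine ih.trans ?_
      unfold urStr
      rw [scan_blockStr_succ]
      simp
  have := key m
  omega

theorem scan_blockStr_snd_eq_nil (T : ℕ)
    (h : ∀ j ≤ T, ∑ t ∈ Finset.Ico j T, a t ≤ ∑ t ∈ Finset.Ico j T, b t) :
    (scan (blockStr a b s s' T)).2 = [] := by
  have key : ∀ T, ∃ j ≤ T, (scan (blockStr a b s s' T)).2.length +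
      ∑ t ∈ Finset.Ico j T, b t = ∑ t ∈ Finset.Ico j T, a t := by
    intro T
    induction T with
    | zero => exact ⟨0, le_rfl, by simp [scan_blockStr_zero]⟩
    | succ T ih =>
      obtain ⟨j, hj, e⟩ := ih
      have e2 : (scan (blockStr a b s s' (T + 1))).2.length =
          (scan (blockStr a b s s' T)).2.length + a T - b T := by
        rw [scan_blockStr_succ]
        simp only [List.length_append, List.length_replicate, List.length_take]
        omega
      by_cases hc : b T ≤ (scan (blockStr a b s s' T)).2.length + a T
      · refine ⟨j, by omega, ?_⟩
        rw [Finset.sum_Ico_succ_top hj, Finset.sum_Ico_succ_top hj, e2]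
        omega
      · refine ⟨T + 1, le_rfl, ?_⟩
        rw [e2]
        simp
        omega
  obtain ⟨j, hj, e⟩ := key T
  have := h j hj
  exact List.length_eq_zero_iff.mp (by omega)

theorem scan_blockStr_snd_of_last {T N : ℕ} (hTN : T < N)
    (h : (scan (blockStr a b s s' T)).2 = [])
    (hb : ∀ t, T ≤ t → b t = 0) (ha : ∀ t, T < t → a t = 0) :
    (scan (blockStr a b s s' N)).2 = List.replicate (a T) (s T) := by
  induction N, Nat.succ_le_of_lt hTN using Nat.le_induction with
  | base => rw [scan_blockStr_succ, h, hb T le_rfl]; simp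
  | succ N hN ih =>
    rw [scan_blockStr_succ, ih (by omega), hb N (by omega), ha N (by omega)]
    simp

end blockStr

theorem Si_succ_eq (A : MS) (k : ℕ) :
    Si A (k + 1) = blockStr (fun t => A.count (k + 1 - t, k + 1)) (fun t => A.count (k - t, k))
      (fun t => (k + 1 - t, k + 1)) (fun t => (k - t, k)) (k + 1) := by
  unfold Si blockStr
  refine List.flatMap_congr fun t ht => ?_
  have : t < k + 1 := List.mem_range.mp ht
  have e1 : k - t + 1 = k + 1 - t := by omega
  have e2 : k + 1 - (t + 1) = k - t := by omega
  simp [e1, e2]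

theorem SiStar_eq (n : ℕ) (A : MS) (i : ℕ) :
    SiStar n A i = blockStr (fun t => A.count (i, i + t)) (fun t => A.count (i + 1, i + t + 1))
      (fun t => (i, i + t)) (fun t => (i + 1, i + t + 1)) n := rfl

/-- `f_{k+1}` moves a segment of block `T` when this block holds the last uncanceled ")". -/
theorem fM_add_of_block {A : MS} {k T : ℕ} (hT : T ≤ k)
    (h1 : ∀ t < T, A.count (k + 1 - t, k + 1) ≤ A.count (k - t, k))
    (h2 : A.count (k + 1 - T, k + 1) < A.count (k - T, k))
    (h3 : ∀ t, T < t → t ≤ k → A.count (k - t, k) ≤ A.count (k + 1 - t, k + 1)) :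
    fM (k + 1) A + {(k - T, k)} = A + {(k - T, k + 1)} := by
  have hl : lastCl (Si A (k + 1)) = some (k - T, k) := by
    unfold lastCl
    rw [Si_succ_eq, scan_blockStr_fst_of_ge _ _ _ _ (T := T + 1) (by omega)
      fun t ht ht' => h3 t (by omega) (by omega), scan_blockStr_succ,
      (scan_blockStr_of_le _ _ _ _ h1).1]
    obtain ⟨w, hw⟩ := Nat.exists_eq_add_of_lt h2
    rw [show A.count (k - T, k) - (([] : List Seg).length + A.count (k + 1 - T, k + 1)) = w + 1 by
      simp; omega, List.replicate_succ']
    simp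
  have hm : (k - T, k) ∈ A := Multiset.count_pos.mp (by omega)
  unfold fM
  rw [hl]
  simp only
  rw [add_right_comm, Multiset.add_comm (A.erase _), Multiset.singleton_add,
    Multiset.cons_erase hm]

theorem fM_eq_add {A : MS} {k : ℕ}
    (h : ∀ t ≤ k, A.count (k - t, k) ≤ A.count (k + 1 - t, k + 1)) :
    fM (k + 1) A = A + {(k + 1, k + 1)} := by
  have hl : lastCl (Si A (k + 1)) = none := by
    unfold lastCl
    rw [Si_succ_eq, scan_blockStr_fst_of_ge _ _ _ _ (T := 0) (by omega)
      fun t _ ht => h t (by omega), scan_blockStr_zero]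
    simp
  unfold fM
  rw [hl]

theorem fM_iterate_eq_add {A : MS} {k : ℕ}
    (h : ∀ t ≤ k, A.count (k - t, k) ≤ A.count (k + 1 - t, k + 1)) (x : ℕ) :
    (fM (k + 1))^[x] A = A + Multiset.replicate x (k + 1, k + 1) := by
  induction x with
  | zero => simp
  | succ x ih =>
    rw [Function.iterate_succ_apply', ih, fM_eq_add, Multiset.replicate_succ, add_assoc,
      Multiset.add_comm (Multiset.replicate _ _), Multiset.singleton_add]
    intro t ht
    have := h t ht
    simp only [Multiset.count_add, Multiset.count_replicate, Prod.mk.injEq]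
    rw [if_neg (by omega)]
    omega

theorem fM_iterate_block {k T : ℕ} (hT : T < k) (w : ℕ) {A : MS}
    (h1 : ∀ t < T, A.count (k + 1 - t, k + 1) ≤ A.count (k - t, k))
    (h2 : A.count (k + 1 - T, k + 1) + w = A.count (k - T, k))
    (h3 : ∀ t, T < t → t ≤ k → A.count (k - t, k) ≤ A.count (k + 1 - t, k + 1)) :
    (fM (k + 1))^[w] A + Multiset.replicate w (k - T, k) =
      A + Multiset.replicate w (k - T, k + 1) := by
  induction w generalizing A with
  | zero => simp
  | succ w ih =>
    have e := fM_add_of_block hT.le h1 (by omega) h3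
    have ec : ∀ x, (fM (k + 1) A).count x + (if x = (k - T, k) then 1 else 0) =
        A.count x + (if x = (k - T, k + 1) then 1 else 0) := fun x => by
      simpa [Multiset.count_add, Multiset.count_singleton] using congrArg (Multiset.count x) e
    have eo : ∀ t ≤ k, (fM (k + 1) A).count (k + 1 - t, k + 1) =
        A.count (k + 1 - t, k + 1) + (if t = T + 1 then 1 else 0) := fun t ht => by
      have := ec (k + 1 - t, k + 1)
      simp only [Prod.mk.injEq, and_true] at this
      split_ifs at this ⊢ <;> omega
    have el : ∀ t ≤ k, (fM (k + 1) A).count (k - t, k) + (if t = T then 1 else 0) =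
        A.count (k - t, k) := fun t ht => by
      have := ec (k - t, k)
      simp only [Prod.mk.injEq, and_true] at this
      split_ifs at this ⊢ <;> omega
    have key := ih (A := fM (k + 1) A)
      (fun t ht => by
        have := h1 t ht; have := eo t (by omega); have := el t (by omega)
        split_ifs at * <;> omega)
      (by
        have := eo T (by omega); have := el T (by omega)
        split_ifs at * <;> omega)
      (fun t ht ht' => by
        have := h3 t ht ht'; have := eo t (by omega); have := el t (by omega)
        split_ifs at * <;> omega)
    rw [Function.iterate_succ_apply, Multiset.replicate_succ, Multiset.replicate_succ,
      ← Multiset.singleton_add, ← Multiset.singleton_add, add_left_comm, key,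
      ← add_assoc, Multiset.add_comm {_}, e, add_assoc]

/-- Effect of `f_{k+1}^{ur}` when the first `T` blocks of `S_{k+1}` carry all uncanceled ")"
and no ")" is canceled outside its block there. -/
theorem fM_iterate_blocks {k T : ℕ} (hT : T ≤ k) {A : MS}
    (h1 : ∀ t < T, A.count (k + 1 - t, k + 1) ≤ A.count (k - t, k))
    (h3 : ∀ t, T ≤ t → t ≤ k → A.count (k - t, k) ≤ A.count (k + 1 - t, k + 1))
    (A' : MS) (hA' : A' = (fM (k + 1))^[∑ t ∈ Finset.range T,
      (A.count (k - t, k) - A.count (k + 1 - t, k + 1))] A) :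
    (∀ h, A'.count (h, k) = if k - T < h ∧ h ≤ k then A.count (h + 1, k + 1) else A.count (h, k)) ∧
    (∀ h, A'.count (h, k + 1) = if k - T < h ∧ h ≤ k then
      A.count (h, k + 1) + A.count (h, k) - A.count (h + 1, k + 1) else A.count (h, k + 1)) ∧
    ∀ h j, j ≠ k → j ≠ k + 1 → A'.count (h, j) = A.count (h, j) := by
  induction T generalizing A with
  | zero =>
    simp only [Finset.range_zero, Finset.sum_empty, Function.iterate_zero, id_eq] at hA'
    subst hA'
    refine ⟨fun h => ?_, fun h => ?_, fun _ _ _ _ => rfl⟩ <;> rw [if_neg (by omega)]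
  | succ T ih =>
    have hle := h1 T (by omega)
    set w := A.count (k - T, k) - A.count (k + 1 - T, k + 1) with hw
    have e := fM_iterate_block (k := k) (T := T) (by omega) w (fun t ht => h1 t (by omega))
      (by omega) (fun t ht ht' => h3 t (by omega) ht')
    set B := (fM (k + 1))^[w] A with hB
    have ec : ∀ h j, B.count (h, j) + (if h = k - T ∧ j = k then w else 0) =
        A.count (h, j) + (if h = k - T ∧ j = k + 1 then w else 0) := fun h j => by
      have := congrArg (Multiset.count (h, j)) e
      simp only [Multiset.count_add, Multiset.count_replicate, Prod.mk.injEq] at this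
      simpa [eq_comm] using this
    have hk : ∀ h, h ≠ k - T → B.count (h, k) = A.count (h, k) := fun h hh => by
      have := ec h k
      rwa [if_neg (by omega), if_neg (by omega)] at this
    have hk' : ∀ h, h ≠ k - T → B.count (h, k + 1) = A.count (h, k + 1) := fun h hh => by
      have := ec h (k + 1)
      rwa [if_neg (by omega), if_neg (by omega)] at this
    have hT1 : B.count (k - T, k) + w = A.count (k - T, k) := by
      have := ec (k - T) k
      rwa [if_pos (by omega), if_neg (by omega)] at this
    have hT2 : B.count (k - T, k + 1) = A.count (k - T, k + 1) + w := by
      have := ec (k - T) (k + 1)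
      rwa [if_neg (by omega), if_pos (by omega)] at this
    have hT3 := hk' (k + 1 - T) (by omega)
    obtain ⟨i1, i2, i3⟩ := ih (A := B) (by omega)
      (fun t ht => by
        rw [hk _ (by omega), hk' _ (by omega)]; exact h1 t (by omega))
      (fun t ht ht' => by
        rcases ht.eq_or_lt with rfl | ht
        · omega
        · rw [hk _ (by omega)]
          have := h3 t ht ht'
          by_cases h' : t = T + 1
          · subst h'
            rw [show k + 1 - (T + 1) = k - T by omega] at this ⊢
            omega
          · rwa [hk' _ (by omega)])
      (by
        have es : ∑ t ∈ Finset.range T, (B.count (k - t, k) - B.count (k + 1 - t, k + 1)) =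
            ∑ t ∈ Finset.range T, (A.count (k - t, k) - A.count (k + 1 - t, k + 1)) :=
          Finset.sum_congr rfl fun t ht => by
            have := Finset.mem_range.mp ht
            rw [hk _ (by omega), hk' _ (by omega)]
        rw [hA', Finset.sum_range_succ, Function.iterate_add_apply, es])
    have e1 : k + 1 - T = k - T + 1 := by omega
    rw [e1] at hle hw hT3
    refine ⟨fun h => ?_, fun h => ?_, fun h j hj hj' => ?_⟩
    · rw [i1]
      by_cases hh : h = k - T
      · subst hh
        rw [if_neg (by omega), if_pos (by omega)]
        omega
      · rw [hk _ hh]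
        by_cases hc : k - T < h ∧ h ≤ k
        · rw [if_pos hc, if_pos (by omega), hk' _ (by omega)]
        · rw [if_neg hc, if_neg (by omega)]
    · rw [i2]
      by_cases hh : h = k - T
      · subst hh
        rw [if_neg (by omega), if_pos (by omega)]
        omega
      · rw [hk _ hh, hk' _ hh]
        by_cases hc : k - T < h ∧ h ≤ k
        · rw [if_pos hc, if_pos (by omega), hk' _ (by omega)]
        · rw [if_neg hc, if_neg (by omega)]
    · have := ec h j
      rw [i3 h j hj hj']
      rwa [if_neg (by omega), if_neg (by omega)] at this

theorem isMS_iff_count {n : ℕ} {A : MS} :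
    IsMS n A ↔ ∀ h j, ¬(1 ≤ h ∧ h ≤ j ∧ j ≤ n) → A.count (h, j) = 0 := by
  refine ⟨fun hA h j hn => Multiset.count_eq_zero.mpr fun hm => hn (hA _ hm), ?_⟩
  rintro hA ⟨h, j⟩ hm
  by_contra hn
  exact Multiset.count_eq_zero.mp (hA h j hn) hm

/-- The properties of `A = M^(k)` describing it in terms of `M`. -/
structure IsMseqLike (n : ℕ) (M : MS) (k : ℕ) (A : MS) : Prop where
  isMS : IsMS n A
  shifted : ∀ h j, 1 ≤ h → h ≤ j → j < k → A.count (h, j) = M.count (h + 1, j + 1)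
  unchanged : ∀ h j, k < j → A.count (h, j) = M.count (h, j)
  dominates : ∀ h m, 1 ≤ h → h ≤ k → k ≤ m → m < n →
    ∑ j ∈ Finset.Ico k (m + 1), M.count (h + 1, j + 1) ≤
      A.count (h, k) + ∑ j ∈ Finset.Ico (k + 1) (m + 1), M.count (h, j)
  inherits : ∀ h j, 1 ≤ h → h ≤ j → j ≤ k →
    ∑ l ∈ Finset.Ico j (k + 1), M.count (h, l) ≤
      A.count (h, k) + ∑ l ∈ Finset.Ico j k, M.count (h + 1, l + 1)

theorem IsMseqLike.count_le {n k : ℕ} {M A : MS} (hA : IsMseqLike n M k A) (hk : k < n) {h : ℕ}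
    (h1 : 1 ≤ h) (h2 : h ≤ k) : A.count (h + 1, k + 1) ≤ A.count (h, k) := by
  have := hA.dominates h k h1 h2 le_rfl hk
  rw [hA.unchanged _ _ (by omega)]
  simpa using this

/-- The counts of `f_{k+1}^a A` with `a = ur_{k+1} + ur_{k+1}^*`. -/
theorem IsMseqLike.count_iterate {n k : ℕ} {M A : MS} (hA : IsMseqLike n M k A) (hk : k < n)
    (A' : MS) (hA' : A' = (fM (k + 1))^[urStr (Si A (k + 1)) + urStr (SiStar n A (k + 1))] A) :
    (∀ h, 1 ≤ h → h ≤ k → A'.count (h, k) = A.count (h + 1, k + 1)) ∧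
    (∀ h, 1 ≤ h → h ≤ k →
      A'.count (h, k + 1) + A.count (h + 1, k + 1) = A.count (h, k + 1) + A.count (h, k)) ∧
    A'.count (k + 1, k + 1) = A.count (k + 1, k + 1) + urStr (SiStar n A (k + 1)) ∧
    (∀ h j, ¬(1 ≤ h ∧ h ≤ k ∧ (j = k ∨ j = k + 1)) → ¬(h = k + 1 ∧ j = k + 1) →
      A'.count (h, j) = A.count (h, j)) := by
  have h0 : A.count (0, k) = 0 := isMS_iff_count.mp hA.isMS _ _ (by omega)
  have h1 : ∀ t < k, A.count (k + 1 - t, k + 1) ≤ A.count (k - t, k) := fun t ht => by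
    have := hA.count_le hk (h := k - t) (by omega) (by omega)
    rwa [show k + 1 - t = k - t + 1 by omega]
  have h3 : ∀ t, k ≤ t → t ≤ k → A.count (k - t, k) ≤ A.count (k + 1 - t, k + 1) :=
    fun t ht ht' => by
      rw [show k - t = 0 by omega, h0]
      exact Nat.zero_le _
  have hur : urStr (Si A (k + 1)) = ∑ t ∈ Finset.range k,
      (A.count (k - t, k) - A.count (k + 1 - t, k + 1)) := by
    unfold urStr
    rw [Si_succ_eq, scan_blockStr_fst_of_ge _ _ _ _ (T := k) (by omega)
      fun t ht ht' => h3 t ht (by omega), (scan_blockStr_of_le _ _ _ _ h1).2]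
  obtain ⟨i1, i2, i3⟩ := fM_iterate_blocks le_rfl h1 h3 _ rfl
  rw [add_comm (urStr _), Function.iterate_add_apply, hur] at hA'
  set B := (fM (k + 1))^[∑ t ∈ Finset.range k,
      (A.count (k - t, k) - A.count (k + 1 - t, k + 1))] A
  rw [fM_iterate_eq_add] at hA'
  · have hc : ∀ h j, A'.count (h, j) = B.count (h, j) +
        (if h = k + 1 ∧ j = k + 1 then urStr (SiStar n A (k + 1)) else 0) := fun h j => by
      rw [hA', Multiset.count_add, Multiset.count_replicate]
      simp [eq_comm]
    refine ⟨fun h hh hh' => ?_, fun h hh hh' => ?_, ?_, fun h j hn hn' => ?_⟩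
    · rw [hc, if_neg (by omega), i1, if_pos (by omega), add_zero]
    · have := hA.count_le hk hh hh'
      rw [hc, if_neg (by omega), i2, if_pos (by omega)]
      omega
    · rw [hc, if_pos (by omega), i2, if_neg (by omega)]
    · rw [hc, if_neg hn', add_zero]
      by_cases e : j = k
      · rw [e, i1, if_neg (by omega)]
      by_cases e' : j = k + 1
      · rw [e', i2, if_neg (by omega)]
      exact i3 h j e e'
  · intro t ht
    by_cases htk : t = k
    · rw [i1, if_neg (by omega), htk, Nat.sub_self, h0]
      exact Nat.zero_le _
    · rw [i1, if_pos (by omega), i2, show k - t + 1 = k + 1 - t by omega]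
      split_ifs with hc
      · have := hA.count_le hk (by omega) hc.2
        omega
      · exact le_rfl

theorem IsMseqLike.iterate {n k : ℕ} {M A : MS} (hA : IsMseqLike n M k A) (hk : k < n) :
    IsMseqLike n M (k + 1)
      ((fM (k + 1))^[urStr (Si A (k + 1)) + urStr (SiStar n A (k + 1))] A) := by
  obtain ⟨c1, c2, c3, c4⟩ := hA.count_iterate hk _ rfl
  set A' := (fM (k + 1))^[urStr (Si A (k + 1)) + urStr (SiStar n A (k + 1))] A
  refine ⟨isMS_iff_count.mpr fun h j hn => ?_, fun h j h1 h2 h3 => ?_, fun h j hj => ?_,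
    fun h m h1 h2 h3 h4 => ?_, fun h j h1 h2 h3 => ?_⟩
  · rw [c4 h j (by omega) (by omega)]
    exact isMS_iff_count.mp hA.isMS h j hn
  · by_cases e : j = k
    · subst e
      rw [c1 h h1 h2, hA.unchanged _ _ (by omega)]
    · rw [c4 h j (by omega) (by omega), hA.shifted h j h1 h2 (by omega)]
  · rw [c4 h j (by omega) (by omega), hA.unchanged _ _ (by omega)]
  · rcases h2.eq_or_lt with rfl | h2
    · have key := sum_closes_le (fun t => A.count (k + 1, k + 1 + t))
        (fun t => A.count (k + 1 + 1, k + 1 + t + 1)) (fun t => (k + 1, k + 1 + t))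
        (fun t => (k + 1 + 1, k + 1 + t + 1)) n (m + 1 - (k + 1)) (by omega)
      rw [← SiStar_eq, ← Finset.sum_Ico_eq_sum_range (fun j => A.count (k + 1, j)),
        ← Finset.sum_Ico_eq_sum_range (fun j => A.count (k + 1 + 1, j + 1)),
        Finset.sum_eq_sum_Ico_succ_bot (a := k + 1) (f := fun j => A.count (k + 1, j)) (by omega),
        Finset.sum_congr rfl fun j hj => hA.unchanged _ (j + 1)
          (by have := Finset.mem_Ico.mp hj; omega),
        Finset.sum_congr rfl fun j hj => hA.unchanged (k + 1) j
          (by have := Finset.mem_Ico.mp hj; omega)] at key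
      rw [c3]
      omega
    · have e := c2 h h1 (by omega)
      have d := hA.dominates h m h1 (by omega) (by omega) h4
      rw [Finset.sum_eq_sum_Ico_succ_bot (a := k) (by omega),
        Finset.sum_eq_sum_Ico_succ_bot (a := k + 1) (f := fun j => M.count (h, j)) (by omega)] at d
      rw [hA.unchanged (h + 1) _ (by omega), hA.unchanged h _ (by omega)] at e
      omega
  · by_cases hh : h = k + 1
    · obtain rfl : j = k + 1 := by omega
      subst hh
      rw [c3, hA.unchanged _ _ (by omega)]
      simp
    · have e := c2 h h1 (by omega)
      rw [hA.unchanged (h + 1) _ (by omega), hA.unchanged h _ (by omega)] at e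
      by_cases hj : j = k + 1
      · subst hj
        have := hA.count_le hk h1 (by omega)
        rw [hA.unchanged _ _ (by omega)] at this
        simp
        omega
      · have d := hA.inherits h j h1 h2 (by omega)
        rw [Finset.sum_Ico_succ_top (b := k + 1) (by omega),
          Finset.sum_Ico_succ_top (b := k) (f := fun l => M.count (h + 1, l + 1)) (by omega)]
        omega

theorem isMseqLike_Mseq {n : ℕ} {M : MS} (hM : IsMS n M) {k : ℕ} (hk : k ≤ n) :
    IsMseqLike n M k (Mseq n M k) := by
  induction k with
  | zero => exact ⟨hM, by omega, fun _ _ _ => rfl, by omega, by omega⟩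
  | succ k ih => exact (ih (by omega)).iterate hk

/-- In `S_i^*(A)` all "(" below segments `[i,j]` with `j < n` are canceled. -/
def IsStarBalanced (n i : ℕ) (A : MS) : Prop :=
  ∀ j ≤ n - i, ∑ t ∈ Finset.Ico j (n - i), A.count (i, i + t) ≤
    ∑ t ∈ Finset.Ico j (n - i), A.count (i + 1, i + t + 1)

theorem headOp_SiStar {n i : ℕ} {A : MS} (hA : IsMS n A) (hi : 1 ≤ i) (hin : i ≤ n)
    (hb : IsStarBalanced n i A) :
    headOp (SiStar n A i) = (List.replicate (A.count (i, n)) (i, n)).head? := by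
  unfold headOp
  rw [SiStar_eq, scan_blockStr_snd_of_last _ _ _ _ (T := n - i) (by omega)
    (scan_blockStr_snd_eq_nil _ _ _ _ _ hb)
    (fun t ht => isMS_iff_count.mp hA _ _ (by omega))
    (fun t ht => isMS_iff_count.mp hA _ _ (by omega)), Nat.add_sub_cancel' hin]

theorem count_eStarMaxAux {n i : ℕ} (hi : 1 ≤ i) (hin : i ≤ n) (fuel : ℕ) {A : MS}
    (hA : IsMS n A) (hb : IsStarBalanced n i A) (hf : A.count (i, n) ≤ fuel) (h j : ℕ) :
    (eStarMaxAux n i fuel A).count (h, j) =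
      if h = i ∧ j = n then 0
      else if h = i + 1 ∧ j = n ∧ i < n then A.count (h, j) + A.count (i, n)
      else A.count (h, j) := by
  induction fuel generalizing A with
  | zero =>
    have h0 : A.count (i, n) = 0 := by omega
    simp only [eStarMaxAux]
    split_ifs with c1 c2
    · rw [c1.1, c1.2, h0]
    · omega
    · rfl
  | succ fuel ih =>
    have hh := headOp_SiStar hA hi hin hb
    rcases Nat.eq_zero_or_pos (A.count (i, n)) with h0 | hpos
    · rw [h0] at hh
      have he : eMStar n i A = none := by
        unfold eMStar
        rw [hh]
        rfl
      simp only [eStarMaxAux, he]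
      split_ifs with c1 c2
      · rw [c1.1, c1.2, h0]
      · omega
      · rfl
    · obtain ⟨x, hx⟩ := Nat.exists_eq_succ_of_ne_zero hpos.ne'
      rw [hx, List.replicate_succ] at hh
      set A' := if n = i then A.erase (i, n) else A.erase (i, n) + {(i + 1, n)} with hA'
      have he : eMStar n i A = some A' := by
        unfold eMStar
        rw [hh]
        rfl
      have hc : ∀ h j, A'.count (h, j) + (if h = i ∧ j = n then 1 else 0) =
          A.count (h, j) + (if h = i + 1 ∧ j = n ∧ i < n then 1 else 0) := fun h j => by
        have e1 : (A.erase (i, n)).count (h, j) + (if h = i ∧ j = n then 1 else 0) =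
            A.count (h, j) := by
          conv_rhs => rw [← Multiset.cons_erase (Multiset.count_pos.mp hpos)]
          simp [Multiset.count_cons]
        by_cases hn : n = i
        · rw [hA', if_pos hn, e1, if_neg (by omega), add_zero]
        · have hin' : i < n := by omega
          rw [hA', if_neg hn, Multiset.count_add, Multiset.count_singleton, add_right_comm, e1]
          simp [hin']
      simp only [eStarMaxAux, he]
      have h1 : A'.count (i, n) + 1 = A.count (i, n) := by
        have := hc i n
        rwa [if_pos (by omega), if_neg (by omega)] at this
      rw [ih (A := A') ?_ ?_ (by omega)]
      · have := hc h j
        split_ifs at this ⊢ <;> omega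
      · refine isMS_iff_count.mpr fun h j hn => ?_
        have := hc h j
        have := isMS_iff_count.mp hA h j hn
        split_ifs at * <;> omega
      · intro l hl
        refine (Finset.sum_le_sum fun t ht => ?_).trans
          ((hb l hl).trans (Finset.sum_le_sum fun t ht => ?_))
        · have := Finset.mem_Ico.mp ht
          have := hc i (i + t)
          split_ifs at * <;> omega
        · have := hc (i + 1) (i + t + 1)
          split_ifs at * <;> omega

theorem count_le_msSize {n i : ℕ} (hin : i ≤ n) (A : MS) : A.count (i, n) ≤ msSize A := by
  induction A using Multiset.induction with
  | empty => simp
  | cons s A ih =>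
    have e : msSize (s ::ₘ A) = (s.2 + 1 - s.1) + msSize A := by simp [msSize]
    rw [Multiset.count_cons, e]
    split_ifs with hs
    · subst hs
      simp only
      omega
    · omega

/-- The properties of the multisegment obtained from `P = M^(n)` after `i` steps
`(e_1^*)^max, …, (e_i^*)^max`. -/
structure IsSigmaLike (n : ℕ) (M P : MS) (i : ℕ) (A : MS) : Prop where
  isMS : IsMS n A
  shifted : ∀ h j, 1 ≤ h → h ≤ j → j < n → A.count (h, j) = M.count (h + 1, j + 1)
  removed : ∀ h ≤ i, A.count (h, n) = 0
  grown : ∀ h, i < h → P.count (h, n) ≤ A.count (h, n)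

theorem IsSigmaLike.isStarBalanced {n i : ℕ} {M P A : MS} (hP : IsMseqLike n M n P)
    (hA : IsSigmaLike n M P i A) : IsStarBalanced n (i + 1) A := by
  intro j hj
  rcases hj.eq_or_lt with rfl | hj
  · simp
  obtain ⟨T, hT⟩ : ∃ T, n = i + 1 + (T + 1) := ⟨n - (i + 1) - 1, by omega⟩
  have e : n - (i + 1) = T + 1 := by omega
  rw [e]
  have key := hP.inherits (i + 1 + 1) (i + 1 + 1 + j) (by omega) (by omega) (by omega)
  have hg := hA.grown (i + 1 + 1) (by omega)
  rw [Finset.sum_Ico_eq_sum_range, Finset.sum_Ico_eq_sum_range] at key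
  rw [Finset.sum_Ico_succ_top (f := fun t => A.count (i + 1 + 1, i + 1 + t + 1)) (by omega),
    Finset.sum_Ico_eq_sum_range, Finset.sum_Ico_eq_sum_range,
    show i + 1 + T + 1 = n by omega]
  rw [show n + 1 - (i + 1 + 1 + j) = T + 1 - j by omega,
    show n - (i + 1 + 1 + j) = T - j by omega] at key
  have s1 : ∑ t ∈ Finset.range (T + 1 - j), A.count (i + 1, i + 1 + (j + t)) =
      ∑ t ∈ Finset.range (T + 1 - j), M.count (i + 1 + 1, i + 1 + 1 + j + t) :=
    Finset.sum_congr rfl fun t ht => by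
      have := Finset.mem_range.mp ht
      rw [hA.shifted _ _ (by omega) (by omega) (by omega)]
      congr 2
      omega
  have s2 : ∑ t ∈ Finset.range (T - j), A.count (i + 1 + 1, i + 1 + (j + t) + 1) =
      ∑ t ∈ Finset.range (T - j), M.count (i + 1 + 1 + 1, i + 1 + 1 + j + t + 1) :=
    Finset.sum_congr rfl fun t ht => by
      have := Finset.mem_range.mp ht
      rw [hA.shifted _ _ (by omega) (by omega) (by omega)]
      congr 2
      omega
  rw [s1, s2]
  omega

theorem IsSigmaLike.eStarMax {n i : ℕ} {M P A : MS} (hP : IsMseqLike n M n P)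
    (hA : IsSigmaLike n M P i A) (hi : i < n) :
    IsSigmaLike n M P (i + 1) (eStarMax n (i + 1) A) := by
  have hc := count_eStarMaxAux (by omega) hi (msSize A) hA.isMS (hA.isStarBalanced hP)
    (count_le_msSize hi A)
  change IsSigmaLike n M P (i + 1) (eStarMaxAux n (i + 1) (msSize A) A)
  refine ⟨isMS_iff_count.mpr fun h j hn => ?_, fun h j h1 h2 h3 => ?_, fun h hh => ?_,
    fun h hh => ?_⟩
  · have := isMS_iff_count.mp hA.isMS h j hn
    rw [hc]
    split_ifs <;> omega
  · rw [hc, if_neg (by omega), if_neg (by omega)]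
    exact hA.shifted h j h1 h2 h3
  · rw [hc]
    by_cases e : h = i + 1
    · rw [if_pos ⟨e, rfl⟩]
    · rw [if_neg (by omega), if_neg (by omega)]
      exact hA.removed h (by omega)
  · have := hA.grown h (by omega)
    rw [hc, if_neg (by omega)]
    split_ifs <;> omega

theorem isSigmaLike_foldl {n : ℕ} {M P : MS} (hP : IsMseqLike n M n P) {i : ℕ} (hi : i ≤ n) :
    IsSigmaLike n M P i ((List.range i).foldl (fun A k => eStarMax n (k + 1) A) P) := by
  induction i with
  | zero =>
    refine ⟨hP.isMS, hP.shifted, fun h hh => ?_, fun _ _ => le_rfl⟩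
    exact isMS_iff_count.mp hP.isMS _ _ (by omega)
  | succ i ih =>
    rw [List.range_succ, List.foldl_append]
    exact (ih (by omega)).eStarMax hP hi

theorem count_shift {n : ℕ} {M : MS} (hM : IsMS n M) (h j : ℕ) :
    ((M.filter (fun s => 2 ≤ s.1)).map (fun s => (s.1 - 1, s.2 - 1))).count (h, j) =
      if 1 ≤ h then M.count (h + 1, j + 1) else 0 := by
  rw [Multiset.count_map, Multiset.filter_filter]
  split_ifs with hh
  · rw [Multiset.count_eq_card_filter_eq]
    refine congrArg _ (Multiset.filter_congr ?_)
    rintro ⟨x, y⟩ hs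
    have := hM _ hs
    simp only [Prod.mk.injEq] at this ⊢
    omega
  · rw [Multiset.card_eq_zero, Multiset.filter_eq_nil]
    rintro ⟨x, y⟩ -
    simp only [Prod.mk.injEq]
    omega

theorem stmt17 (n : ℕ) (M : MS) (hM : IsMS n M) :
    sigmaMS n M = (M.filter (fun s => 2 ≤ s.1)).map (fun s => (s.1 - 1, s.2 - 1)) := by
  have hA := isSigmaLike_foldl (isMseqLike_Mseq hM le_rfl) le_rfl
  change IsSigmaLike n M _ n (sigmaMS n M) at hA
  ext ⟨h, j⟩
  rw [count_shift hM]
  by_cases hc : 1 ≤ h ∧ h ≤ j ∧ j < n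
  · rw [if_pos hc.1, hA.shifted h j hc.1 hc.2.1 hc.2.2]
  · have h0 : (sigmaMS n M).count (h, j) = 0 := by
      by_cases e : h ≤ n ∧ j = n
      · rw [e.2]
        exact hA.removed h e.1
      · exact isMS_iff_count.mp hA.isMS _ _ (by omega)
    rw [h0]
    split_ifs with hh
    · exact (isMS_iff_count.mp hM _ _ (by omega)).symm
    · rfl
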